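/- Let K be a compact subset of ℂ with ℂ \ K connected, let f be holomorphic on an open neighbourhood of K, let a_1, …, a_m ∈ K, and let ε > 0. Then there exists a Dirichlet polynomial D such that |f(z) − D(z)| < ε for all z ∈ K and D(a_j) = f(a_j) for j = 1, …, m. -/

import Mathlib

open Complex Set

/-- A Dirichlet polynomial: a function of the form `z ↦ ∑_{k=1}^m a_k k^{-z}`. -/
def IsDirichletPolynomial (f : ℂ → ℂ) : Prop :=
  ∃ (m : ℕ) (a : ℕ → ℂ), ∀ z : ℂ, f z = ∑ k ∈ Finset.Icc 1 m, a k * (k : ℂ) ^ (-z)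

open Filter Topology MeasureTheory

theorem Differentiable.exists_eq_prod_sub_mul {F : ℂ → ℂ} (hF : Differentiable ℂ F)
    (S : Finset ℂ) (hS : ∀ a ∈ S, F a = 0) :
    ∃ G : ℂ → ℂ, Differentiable ℂ G ∧ ∀ w, F w = (∏ a ∈ S, (w - a)) * G w := by
  classical
  induction S using Finset.induction_on with
  | empty => exact ⟨F, hF, fun w => by simp⟩
  | insert b S hb ih =>
    obtain ⟨G, hG, hFG⟩ := ih fun a ha => hS a (Finset.mem_insert_of_mem ha)
    have hGb : G b = 0 := by
      have h := hFG b
      rw [hS b (Finset.mem_insert_self b S), eq_comm, mul_eq_zero] at h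
      refine h.resolve_left (Finset.prod_ne_zero_iff.2 fun a ha => sub_ne_zero.2 ?_)
      rintro rfl
      exact hb ha
    refine ⟨dslope G b, ?_, fun w => ?_⟩
    · rw [← differentiableOn_univ] at hG ⊢
      exact (differentiableOn_dslope univ_mem).2 hG
    · have h := sub_smul_dslope G b w
      rw [hGb, sub_zero, smul_eq_mul] at h
      rw [hFG w, Finset.prod_insert hb, ← h]
      ring

/-- Schwarz-type estimate: each zero in the disc of radius `r` gains a factor `1 / 2`. -/
theorem Differentiable.norm_le_of_zeros {F : ℂ → ℂ} (hF : Differentiable ℂ F)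
    {r M : ℝ} (hr : 0 < r) (hM : ∀ w ∈ Metric.sphere (0 : ℂ) (5 * r), ‖F w‖ ≤ M)
    (S : Finset ℂ) (hS : ∀ a ∈ S, F a = 0) (hSr : ∀ a ∈ S, ‖a‖ ≤ r) {w : ℂ} (hw : ‖w‖ ≤ r) :
    ‖F w‖ ≤ M / 2 ^ S.card := by
  obtain ⟨G, hG, hFG⟩ := hF.exists_eq_prod_sub_mul S hS
  have hGle : ‖G w‖ ≤ M / (4 * r) ^ S.card := by
    refine Complex.norm_le_of_forall_mem_frontier_norm_le (U := Metric.ball 0 (5 * r))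
      Metric.isBounded_ball hG.diffContOnCl (fun ζ hζ => ?_) (subset_closure ?_)
    · rw [frontier_ball _ (by positivity)] at hζ
      have hprod : (4 * r) ^ S.card ≤ ∏ a ∈ S, ‖ζ - a‖ := by
        rw [← Finset.prod_const]
        refine Finset.prod_le_prod (fun _ _ => by positivity) fun a ha => ?_
        have h1 := norm_sub_norm_le ζ a
        have h2 : ‖ζ‖ = 5 * r := by simpa using hζ
        linarith [hSr a ha]
      have h := hM ζ hζ
      rw [hFG ζ, norm_mul, norm_prod] at h
      rw [le_div_iff₀ (by positivity), mul_comm]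
      exact (mul_le_mul_of_nonneg_right hprod (norm_nonneg _)).trans h
    · simp only [Metric.mem_ball, dist_zero_right]
      linarith
  have hprod : ∏ a ∈ S, ‖w - a‖ ≤ (2 * r) ^ S.card := by
    rw [← Finset.prod_const]
    refine Finset.prod_le_prod (fun _ _ => by positivity) fun a ha => ?_
    linarith [norm_sub_le w a, hSr a ha]
  rw [hFG w, norm_mul, norm_prod]
  refine (mul_le_mul hprod hGle (norm_nonneg _) (by positivity)).trans_eq ?_
  rw [show 4 * r = 2 * (2 * r) by ring, mul_pow 2 (2 * r)]
  field_simp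

/-- An entire function of exponential type which vanishes at `log k` for all `k ≥ 1` is zero. -/
theorem Differentiable.eq_zero_of_log_zeros {F : ℂ → ℂ} (hF : Differentiable ℂ F) {C : ℝ} {R : ℕ}
    (hFR : ∀ w, ‖F w‖ ≤ C * Real.exp (R * ‖w‖))
    (hzero : ∀ k : ℕ, 1 ≤ k → F (Real.log k : ℂ) = 0) (w : ℂ) : F w = 0 := by
  have hlog : Tendsto (fun N : ℕ => Real.log N) atTop atTop :=
    Real.tendsto_log_atTop.comp tendsto_natCast_atTop_atTop
  have hlim : Tendsto (fun N : ℕ => C * ((N : ℝ) ^ (5 * R) / 2 ^ N)) atTop (𝓝 0) := by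
    simpa using (tendsto_pow_const_div_const_pow_of_one_lt (5 * R) one_lt_two).const_mul C
  refine norm_le_zero_iff.1 (ge_of_tendsto hlim ?_)
  filter_upwards [hlog.eventually_ge_atTop ‖w‖, hlog.eventually_gt_atTop 0,
    eventually_ge_atTop 1] with N hwN hN hN1
  have hN0 : (0 : ℝ) < N := by exact_mod_cast hN1
  have hinj : Set.InjOn (fun k : ℕ => (Real.log k : ℂ)) (Finset.Icc 1 N : Finset ℕ) := by
    intro k hk l hl hkl
    have hk : 1 ≤ k := (Finset.mem_Icc.1 hk).1
    have hl : 1 ≤ l := (Finset.mem_Icc.1 hl).1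
    have h : Real.log k = Real.log l := Complex.ofReal_injective hkl
    exact_mod_cast Real.log_injOn_pos (show (0 : ℝ) < k by exact_mod_cast hk)
      (show (0 : ℝ) < l by exact_mod_cast hl) h
  have key := hF.norm_le_of_zeros (M := C * (N : ℝ) ^ (5 * R)) hN (fun ζ hζ => ?_)
    ((Finset.Icc 1 N).image fun k : ℕ => (Real.log k : ℂ)) ?_ ?_ hwN
  · rwa [Finset.card_image_of_injOn hinj, Nat.card_Icc, Nat.add_sub_cancel, mul_div_assoc] at key
  · refine (hFR ζ).trans_eq ?_
    have h : ‖ζ‖ = 5 * Real.log N := by simpa using hζ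
    rw [h, ← Real.exp_log (pow_pos hN0 (5 * R)), Real.log_pow]
    push_cast
    ring_nf
  · simp only [Finset.mem_image, Finset.mem_Icc]
    rintro _ ⟨k, hk, rfl⟩
    exact hzero k hk.1
  · simp only [Finset.mem_image, Finset.mem_Icc]
    rintro _ ⟨k, hk, rfl⟩
    have hk0 : (1 : ℝ) ≤ k := by exact_mod_cast hk.1
    rw [Complex.norm_real, Real.norm_of_nonneg (Real.log_nonneg hk0)]
    exact Real.log_le_log (by positivity) (by exact_mod_cast hk.2)

theorem NormedSpace.norm_exp_le_exp_norm {A : Type*} [NormedCommRing A] [NormedAlgebra ℂ A]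
    [NormOneClass A] (x : A) :
    ‖NormedSpace.exp x‖ ≤ Real.exp ‖x‖ := by
  rw [NormedSpace.exp_eq_tsum ℂ]
  have h : HasSum (fun n : ℕ => ‖x‖ ^ n / n.factorial) (Real.exp ‖x‖) := by
    rw [Real.exp_eq_exp_ℝ]
    exact NormedSpace.expSeries_div_hasSum_exp ‖x‖
  refine tsum_of_norm_bounded h fun n => ?_
  rw [norm_smul, norm_inv, RCLike.norm_natCast, ← div_eq_inv_mul]
  gcongr
  exact norm_pow_le x n

section Functional

variable {A : Type*} [NormedCommRing A] [NormedAlgebra ℂ A] [CompleteSpace A]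

theorem StrongDual.map_pow_eq_zero_of_exp_smul (φ : StrongDual ℂ A) (x : A)
    (h : ∀ w : ℂ, φ (NormedSpace.exp (w • x)) = 0) (n : ℕ) : φ (x ^ n) = 0 := by
  suffices H : ∀ w : ℂ, φ (x ^ n * NormedSpace.exp (w • x)) = 0 by
    simpa using H 0
  induction n with
  | zero => simpa using h
  | succ n ih =>
    intro w
    have h1 := φ.hasFDerivAt.comp_hasDerivAt w ((hasDerivAt_exp_smul_const' x w).const_mul (x ^ n))
    have h2 : (φ ∘ fun u : ℂ => x ^ n * NormedSpace.exp (u • x)) = fun _ => 0 := funext ih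
    rw [h2] at h1
    rw [pow_succ, mul_assoc]
    exact h1.unique (hasDerivAt_const w 0)

/-- A functional which vanishes at `exp (log k • x)` for all `k ≥ 1` vanishes at all powers. -/
theorem StrongDual.map_pow_eq_zero_of_exp_log_smul [NormOneClass A] (φ : StrongDual ℂ A) (x : A)
    (h : ∀ k : ℕ, 1 ≤ k → φ (NormedSpace.exp ((Real.log k : ℂ) • x)) = 0) (n : ℕ) :
    φ (x ^ n) = 0 := by
  obtain ⟨R, hR⟩ := exists_nat_ge ‖x‖
  refine φ.map_pow_eq_zero_of_exp_smul x (fun w => ?_) n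
  refine Differentiable.eq_zero_of_log_zeros (F := fun w => φ (NormedSpace.exp (w • x)))
    (C := ‖φ‖) (R := R) (fun w => ?_) (fun w => ?_) h w
  · exact (φ.hasFDerivAt.comp_hasDerivAt w
      (hasDerivAt_exp_smul_const' x w)).differentiableAt
  · refine (φ.le_opNorm _).trans (mul_le_mul_of_nonneg_left ?_ (norm_nonneg φ))
    refine (NormedSpace.norm_exp_le_exp_norm _).trans (Real.exp_le_exp.2 ?_)
    rw [norm_smul, mul_comm]
    gcongr

/-- A functional which vanishes at all powers of `x` vanishes at the resolvents `(ζ - x)⁻¹`,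
provided the resolvent set of `x` is connected. -/
theorem StrongDual.map_resolvent_eq_zero [NormOneClass A] (φ : StrongDual ℂ A) (x : A)
    (hpow : ∀ n : ℕ, φ (x ^ n) = 0) (hconn : IsPreconnected (resolventSet ℂ x)) {ζ : ℂ}
    (hζ : ζ ∈ resolventSet ℂ x) : φ (resolvent x ζ) = 0 := by
  have hopen : IsOpen (resolventSet ℂ x) := spectrum.isOpen_resolventSet x
  have hlarge : ∀ w : ℂ, ‖x‖ < ‖w‖ → φ (resolvent x w) = 0 := by
    intro w hw
    have hw0 : w ≠ 0 := norm_pos_iff.1 ((norm_nonneg x).trans_lt hw)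
    have hlt : ‖w⁻¹ • x‖ < 1 := by
      rw [norm_smul, norm_inv, inv_mul_lt_iff₀ (norm_pos_iff.2 hw0), mul_one]
      exact hw
    have hres : resolvent x w = w⁻¹ • ∑' n : ℕ, (w⁻¹ • x) ^ n := by
      have h : w • resolvent x w = resolvent (w⁻¹ • x) (1 : ℂ) :=
        spectrum.units_smul_resolvent_self (r := Units.mk0 w hw0) (a := x)
      rw [resolvent.eq_1 (w⁻¹ • x), map_one, NormedRing.inverse_one_sub _ hlt] at h
      exact (eq_inv_smul_iff₀ hw0).2 h
    rw [hres, map_smul, φ.map_tsum (summable_geometric_of_norm_lt_one hlt)]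
    simp [smul_pow, hpow]
  have hdiff : DifferentiableOn ℂ (fun w => φ (resolvent x w)) (resolventSet ℂ x) := fun w hw =>
    (φ.hasFDerivAt.comp_hasDerivAt w
      (spectrum.hasDerivAt_resolvent_const_left hw)).differentiableAt.differentiableWithinAt
  obtain ⟨w₀, hw₀⟩ : ∃ w₀ : ℂ, ‖x‖ < ‖w₀‖ := NormedField.exists_lt_norm ℂ _
  refine (hdiff.analyticOnNhd hopen).eqOn_zero_of_preconnected_of_eventuallyEq_zero hconn
    (spectrum.mem_resolventSet_of_norm_lt hw₀) ?_ hζ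
  filter_upwards [continuous_norm.continuousAt.eventually (lt_mem_nhds hw₀)] with w hw
  exact hlarge w hw

end Functional

theorem Submodule.mem_topologicalClosure_of_forall_dual {E : Type*} [NormedAddCommGroup E]
    [NormedSpace ℂ E] (p : Submodule ℂ E) (x : E)
    (h : ∀ φ : StrongDual ℂ E, (∀ y ∈ p, φ y = 0) → φ x = 0) : x ∈ p.topologicalClosure := by
  by_contra hx
  obtain ⟨φ, u, hu, hux⟩ := RCLike.geometric_hahn_banach_closed_point (𝕜 := ℂ)
    (s := (p.topologicalClosure : Set E)) (p.topologicalClosure.restrictScalars ℝ).convex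
    p.isClosed_topologicalClosure hx
  have h0 : 0 < u := by simpa using hu 0 (zero_mem _)
  have hφ : ∀ y ∈ p, φ y = 0 := by
    intro y hy
    by_contra hne
    have := hu (((u : ℂ) * (φ y)⁻¹) • y)
      (p.topologicalClosure.smul_mem _ (p.le_topologicalClosure hy))
    simp [hne] at this
  rw [h φ hφ] at hux
  simp at hux
  linarith

/-- Twice the Wirtinger derivative `∂f/∂z̄`. -/
noncomputable def dbar (u : ℂ → ℂ) (ζ : ℂ) : ℂ := fderiv ℝ u ζ 1 + I * fderiv ℝ u ζ I

theorem dbar_mul_of_differentiableAt {u g : ℂ → ℂ} {ζ : ℂ} (hu : DifferentiableAt ℝ u ζ)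
    (hg : DifferentiableAt ℂ g ζ) : dbar (fun w => u w * g w) ζ = dbar u ζ * g ζ := by
  have hg' := hg.hasDerivAt.hasFDerivAt.restrictScalars ℝ
  have h : fderiv ℝ (fun w => u w * g w) ζ = _ := (hu.hasFDerivAt.mul hg').fderiv
  simp only [dbar, h]
  simp
  linear_combination u ζ * deriv g ζ * I_mul_I

theorem dbar_eq_zero_of_notMem_tsupport {u : ℂ → ℂ} {ζ : ℂ} (h : ζ ∉ tsupport u) :
    dbar u ζ = 0 := by
  have : fderiv ℝ u ζ = 0 := by
    by_contra hne
    exact h (support_fderiv_subset ℝ hne)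
  simp [dbar, this]

theorem ContDiff.continuous_dbar {u : ℂ → ℂ} (hu : ContDiff ℝ 1 u) : Continuous (dbar u) := by
  have := hu.continuous_fderiv one_ne_zero
  unfold dbar
  fun_prop

theorem integral_dbar_eq_zero {u : ℂ → ℂ} (hu : ContDiff ℝ 1 u) (hc : HasCompactSupport u) :
    ∫ ζ, dbar u ζ = 0 := by
  have hint : ∀ v : ℂ, Integrable (fun ζ => fderiv ℝ u ζ v) := fun v =>
    ((hu.continuous_fderiv one_ne_zero).clm_apply continuous_const).integrable_of_hasCompactSupport
      (hc.fderiv_apply ℝ v)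
  have key : ∀ v : ℂ, ∫ ζ, fderiv ℝ u ζ v = 0 := by
    intro v
    have h := integral_mul_fderiv_eq_neg_fderiv_mul_of_integrable (𝕜 := ℂ) (μ := volume)
      (f := fun _ : ℂ => (1 : ℂ)) (g := u) (v := v) (by simp) (by simpa using hint v)
      (by simpa using hu.continuous.integrable_of_hasCompactSupport hc)
      (fun _ _ => differentiableAt_const _)
      (fun _ _ => (hu.differentiable one_ne_zero).differentiableAt)
    simpa using h
  simp only [dbar]
  rw [integral_add (hint 1) ((hint I).const_mul I), integral_const_mul, key, key]
  simp

theorem integral_dbar_mul_eq_zero {u g : ℂ → ℂ} {U : Set ℂ} (hu : ContDiff ℝ 1 u)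
    (hc : HasCompactSupport u) (hU : IsOpen U) (huU : tsupport u ⊆ U)
    (hg : DifferentiableOn ℂ g U) : ∫ ζ, dbar u ζ * g ζ = 0 := by
  have hsm : ContDiff ℝ 1 fun ζ => u ζ * g ζ := by
    rw [contDiff_iff_contDiffAt]
    intro ζ
    by_cases hζ : ζ ∈ tsupport u
    · exact hu.contDiffAt.mul (((hg.contDiffOn hU).contDiffAt
        (hU.mem_nhds (huU hζ))).restrict_scalars ℝ)
    · refine (contDiffAt_const (c := (0 : ℂ))).congr_of_eventuallyEq ?_
      filter_upwards [(isClosed_tsupport u).isOpen_compl.mem_nhds hζ] with w hw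
      rw [image_eq_zero_of_notMem_tsupport hw, zero_mul]
  rw [← integral_dbar_eq_zero hsm hc.mul_right]
  refine integral_congr_ae (Eventually.of_forall fun ζ => ?_)
  by_cases hζ : ζ ∈ tsupport u
  · exact (dbar_mul_of_differentiableAt (hu.differentiable one_ne_zero).differentiableAt
      (hg.differentiableAt (hU.mem_nhds (huU hζ)))).symm
  · have h : ζ ∉ tsupport fun ζ => u ζ * g ζ := fun h => hζ (tsupport_mul_subset_left h)
    simp only [dbar_eq_zero_of_notMem_tsupport hζ, dbar_eq_zero_of_notMem_tsupport h, zero_mul]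

/-- A radial cutoff function equal to `1` on the unit disc. -/
noncomputable def radialCutoff (ζ : ℂ) : ℂ := (Real.smoothTransition (2 - normSq ζ) : ℝ)

theorem contDiff_normSq : ContDiff ℝ 1 (normSq : ℂ → ℝ) := by
  have : (normSq : ℂ → ℝ) = fun z => z.re * z.re + z.im * z.im := funext normSq_apply
  rw [this]
  exact (reCLM.contDiff.mul reCLM.contDiff).add (imCLM.contDiff.mul imCLM.contDiff)

theorem contDiff_radialCutoff : ContDiff ℝ 1 radialCutoff :=
  ofRealCLM.contDiff.comp (Real.smoothTransition.contDiff.comp (contDiff_const.sub contDiff_normSq))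

theorem hasCompactSupport_radialCutoff : HasCompactSupport radialCutoff := by
  refine HasCompactSupport.intro (isCompact_closedBall (0 : ℂ) 2) fun ζ hζ => ?_
  have h : 2 < ‖ζ‖ := by simpa using hζ
  rw [radialCutoff, Real.smoothTransition.zero_of_nonpos, ofReal_zero]
  rw [normSq_eq_norm_sq]
  nlinarith

theorem radialCutoff_eq_one {ζ : ℂ} (h : ‖ζ‖ ≤ 1) : radialCutoff ζ = 1 := by
  rw [radialCutoff, Real.smoothTransition.one_of_one_le, ofReal_one]
  rw [normSq_eq_norm_sq]
  nlinarith [norm_nonneg ζ]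

theorem dbar_radialCutoff (ζ : ℂ) :
    dbar radialCutoff ζ = -2 * (deriv Real.smoothTransition (2 - normSq ζ) : ℝ) * ζ := by
  have h1 : HasDerivAt Real.smoothTransition (deriv Real.smoothTransition (2 - normSq ζ))
      (2 - normSq ζ) :=
    ((Real.smoothTransition.contDiff (n := 1)).differentiable
      one_ne_zero).differentiableAt.hasDerivAt
  have hn : HasFDerivAt (fun z : ℂ => 2 - normSq z)
      (-((ζ.re • reCLM + ζ.re • reCLM) + (ζ.im • imCLM + ζ.im • imCLM))) ζ := by
    have : (fun z : ℂ => 2 - normSq z) = fun z => 2 - (z.re * z.re + z.im * z.im) :=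
      funext fun z => by rw [normSq_apply]
    rw [this]
    exact ((reCLM.hasFDerivAt.mul reCLM.hasFDerivAt).add
      (imCLM.hasFDerivAt.mul imCLM.hasFDerivAt)).const_sub 2
  have h2 := ofRealCLM.hasFDerivAt.comp ζ (h1.hasFDerivAt.comp ζ hn)
  have h3 : fderiv ℝ radialCutoff ζ = _ := h2.fderiv
  rw [dbar, h3]
  apply Complex.ext <;> simp <;> ring

theorem integral_dbar_radialCutoff_ne_zero : ∫ ζ, dbar radialCutoff ζ * ζ⁻¹ ≠ 0 := by
  set g : ℂ → ℝ := fun ζ => deriv Real.smoothTransition (2 - normSq ζ) with hg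
  have hmono : Monotone Real.smoothTransition := Real.smoothTransition.monotone
  have hcont : Continuous g :=
    ((Real.smoothTransition.contDiff (n := 1)).continuous_deriv le_rfl).comp
      (continuous_const.sub continuous_normSq)
  have hcpt : HasCompactSupport g := by
    refine HasCompactSupport.intro (isCompact_closedBall (0 : ℂ) 2) fun ζ hζ => ?_
    have h : 2 < ‖ζ‖ := by simpa using hζ
    have hneg : 2 - normSq ζ < 0 := by
      rw [normSq_eq_norm_sq]
      nlinarith
    have : Real.smoothTransition =ᶠ[𝓝 (2 - normSq ζ)] fun _ => 0 := by
      filter_upwards [gt_mem_nhds hneg] with t ht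
      exact Real.smoothTransition.zero_of_nonpos (le_of_lt ht)
    simp [hg, this.deriv_eq]
  obtain ⟨t, ht, hdt⟩ : ∃ t ∈ Ioo (0 : ℝ) 1, deriv Real.smoothTransition t =
      (Real.smoothTransition 1 - Real.smoothTransition 0) / (1 - 0) :=
    exists_deriv_eq_slope _ one_pos Real.smoothTransition.continuous.continuousOn
      ((Real.smoothTransition.contDiff (n := 1)).differentiable one_ne_zero).differentiableOn
  have hgt : g (Real.sqrt (2 - t) : ℝ) ≠ 0 := by
    have : normSq (Real.sqrt (2 - t) : ℝ) = 2 - t := by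
      rw [normSq_ofReal, Real.mul_self_sqrt]
      linarith [ht.2]
    simp [hg, this, hdt, Real.smoothTransition.one, Real.smoothTransition.zero]
  have hpos : 0 < ∫ ζ, g ζ := hcont.integral_pos_of_hasCompactSupport_nonneg_nonzero hcpt
    (fun ζ => hmono.deriv_nonneg) hgt
  have heq : ∫ ζ, dbar radialCutoff ζ * ζ⁻¹ = ∫ ζ, -2 * (g ζ : ℂ) := by
    refine integral_congr_ae ?_
    filter_upwards [compl_mem_ae_iff.2 (measure_singleton (0 : ℂ))] with ζ hζ
    have h0 : ζ ≠ 0 := hζ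
    rw [dbar_radialCutoff, mul_assoc, mul_inv_cancel₀ h0, mul_one]
  rw [heq, integral_const_mul, integral_complex_ofReal]
  simpa using hpos.ne'

theorem dbar_comp_sub_const (u : ℂ → ℂ) (z ζ : ℂ) :
    dbar (fun w => u (w - z)) ζ = dbar u (ζ - z) := by
  simp only [dbar, fderiv_comp_sub]

theorem dbar_sub {u v : ℂ → ℂ} {ζ : ℂ} (hu : DifferentiableAt ℝ u ζ)
    (hv : DifferentiableAt ℝ v ζ) : dbar (fun w => u w - v w) ζ = dbar u ζ - dbar v ζ := by
  simp only [dbar, fderiv_fun_sub hu hv]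
  simp
  ring

theorem dbar_eq_zero_of_eventuallyEq_one {u : ℂ → ℂ} {ζ : ℂ} (h : ∀ᶠ w in 𝓝 ζ, u w = 1) :
    dbar u ζ = 0 := by
  have : u =ᶠ[𝓝 ζ] fun _ => 1 := h
  simp [dbar, this.fderiv_eq]

theorem tsupport_dbar_subset (u : ℂ → ℂ) : tsupport (dbar u) ⊆ tsupport u :=
  closure_minimal (fun _ hζ => by_contra fun h => hζ (dbar_eq_zero_of_notMem_tsupport h))
    (isClosed_tsupport u)

theorem notMem_tsupport_dbar {u : ℂ → ℂ} {z : ℂ} (hz : ∀ᶠ w in 𝓝 z, u w = 1) :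
    z ∉ tsupport (dbar u) := by
  rw [notMem_tsupport_iff_eventuallyEq]
  filter_upwards [hz.eventually_nhds] with w hw
  exact dbar_eq_zero_of_eventuallyEq_one hw

theorem integrable_dbar_smul {E : Type*} [NormedAddCommGroup E] [NormedSpace ℂ E]
    {χ : ℂ → ℂ} {g : ℂ → E} (hχ : ContDiff ℝ 1 χ) (hc : HasCompactSupport χ)
    (hg : ∀ ζ ∈ tsupport (dbar χ), ContinuousAt g ζ) : Integrable fun ζ => dbar χ ζ • g ζ := by
  refine Continuous.integrable_of_hasCompactSupport (continuous_iff_continuousAt.2 fun ζ => ?_) ?_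
  · by_cases hζ : ζ ∈ tsupport (dbar χ)
    · exact hχ.continuous_dbar.continuousAt.smul (hg ζ hζ)
    · refine (continuousAt_const (y := (0 : E))).congr ?_
      filter_upwards [notMem_tsupport_iff_eventuallyEq.1 hζ] with w hw
      simp [hw]
  · exact HasCompactSupport.smul_right
      (hc.of_isClosed_subset (isClosed_tsupport _) (tsupport_dbar_subset χ))

theorem integrable_dbar_mul_inv_sub {χ : ℂ → ℂ} (hχ : ContDiff ℝ 1 χ) (hc : HasCompactSupport χ)
    {z : ℂ} (hz : ∀ᶠ w in 𝓝 z, χ w = 1) : Integrable fun ζ => dbar χ ζ * (ζ - z)⁻¹ := by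
  refine integrable_dbar_smul hχ hc fun ζ hζ => ?_
  have hne : ζ - z ≠ 0 := by
    rw [sub_ne_zero]
    rintro rfl
    exact notMem_tsupport_dbar hz hζ
  exact (continuousAt_id.sub continuousAt_const).inv₀ hne

/-- The Cauchy–Pompeiu formula for a cutoff function, up to the value of the constant. -/
theorem integral_dbar_mul_inv_sub {χ : ℂ → ℂ} (hχ : ContDiff ℝ 1 χ) (hc : HasCompactSupport χ)
    {z : ℂ} (hz : ∀ᶠ w in 𝓝 z, χ w = 1) :
    ∫ ζ, dbar χ ζ * (ζ - z)⁻¹ = ∫ ζ, dbar radialCutoff ζ * ζ⁻¹ := by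
  set ψ : ℂ → ℂ := fun ζ => radialCutoff (ζ - z) with hψdef
  have hψ : ContDiff ℝ 1 ψ := contDiff_radialCutoff.comp (contDiff_id.sub contDiff_const)
  have hψc : HasCompactSupport ψ :=
    hasCompactSupport_radialCutoff.comp_homeomorph (Homeomorph.subRight z)
  have hψz : ∀ᶠ w in 𝓝 z, ψ w = 1 := by
    filter_upwards [Metric.closedBall_mem_nhds z one_pos] with w hw
    exact radialCutoff_eq_one (by simpa [dist_eq_norm] using hw)
  have hshift : ∫ ζ, dbar ψ ζ * (ζ - z)⁻¹ = ∫ ζ, dbar radialCutoff ζ * ζ⁻¹ := by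
    simp only [hψdef, dbar_comp_sub_const]
    exact integral_sub_right_eq_self (fun ζ => dbar radialCutoff ζ * ζ⁻¹) z
  have hzero : ∫ ζ, dbar (fun w => χ w - ψ w) ζ * (ζ - z)⁻¹ = 0 := by
    refine integral_dbar_mul_eq_zero (U := {z}ᶜ) (hχ.sub hψ) (hc.sub hψc)
      isOpen_compl_singleton ?_ ?_
    · rintro ζ hζ rfl
      refine (notMem_tsupport_iff_eventuallyEq.2 ?_) hζ
      filter_upwards [hz, hψz] with w h1 h2
      simp [h1, h2]
    · intro ζ hζ
      exact ((differentiableAt_id.sub_const z).inv (sub_ne_zero.2 hζ)).differentiableWithinAt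
  rw [← hshift, ← sub_eq_zero, ← integral_sub (integrable_dbar_mul_inv_sub hχ hc hz)
    (integrable_dbar_mul_inv_sub hψ hψc hψz), ← hzero]
  congr 1 with ζ
  rw [dbar_sub (hχ.differentiable one_ne_zero).differentiableAt
    (hψ.differentiable one_ne_zero).differentiableAt]
  ring

/-- The Cauchy–Pompeiu formula for a holomorphic function times a cutoff function, up to the
value of the constant. -/
theorem integral_dbar_mul_mul_inv_sub {χ f : ℂ → ℂ} {V : Set ℂ} (hχ : ContDiff ℝ 1 χ)
    (hc : HasCompactSupport χ) (hV : IsOpen V) (hχV : tsupport χ ⊆ V)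
    (hf : DifferentiableOn ℂ f V) {z : ℂ} (hz : ∀ᶠ w in 𝓝 z, χ w = 1) :
    ∫ ζ, dbar χ ζ * (f ζ * (ζ - z)⁻¹) = f z * ∫ ζ, dbar radialCutoff ζ * ζ⁻¹ := by
  have hzV : z ∈ V := by
    refine hχV (subset_tsupport χ ?_)
    simp [hz.self_of_nhds]
  have h0 := integral_dbar_mul_eq_zero hχ hc hV hχV
    ((differentiableOn_dslope (hV.mem_nhds hzV)).2 hf)
  have heq : ∀ ζ, dbar χ ζ * (f ζ * (ζ - z)⁻¹) =
      dbar χ ζ * dslope f z ζ + f z * (dbar χ ζ * (ζ - z)⁻¹) := by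
    intro ζ
    rcases eq_or_ne ζ z with rfl | hne
    · simp [dbar_eq_zero_of_eventuallyEq_one hz]
    · rw [dslope_of_ne f hne, slope_def_field]
      ring
  simp_rw [heq]
  rw [integral_add, h0, zero_add, integral_const_mul, integral_dbar_mul_inv_sub hχ hc hz]
  · refine integrable_dbar_smul hχ hc fun ζ hζ => ?_
    exact ((differentiableOn_dslope (hV.mem_nhds hzV)).2 hf).continuousOn.continuousAt
      (hV.mem_nhds (hχV (tsupport_dbar_subset χ hζ)))
  · exact (integrable_dbar_mul_inv_sub hχ hc hz).const_mul _

theorem exists_cutoff {K V : Set ℂ} (hK : IsCompact K) (hV : IsOpen V) (hKV : K ⊆ V) :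
    ∃ χ : ℂ → ℂ, ContDiff ℝ 1 χ ∧ HasCompactSupport χ ∧ tsupport χ ⊆ V ∧
      ∀ z ∈ K, ∀ᶠ w in 𝓝 z, χ w = 1 := by
  obtain ⟨L, hL, hKL, hLV⟩ := exists_compact_between hK hV hKV
  obtain ⟨χ, h1, h0, -⟩ := exists_contMDiffMap_one_nhds_of_subset_interior (n := 1)
    (modelWithCornersSelf ℝ ℂ) hK.isClosed hKL
  have hsupp : tsupport (fun z => (χ z : ℂ)) ⊆ L := by
    refine closure_minimal (fun z hz => by_contra fun h => hz ?_) hL.isClosed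
    simp [h0 z h]
  refine ⟨fun z => (χ z : ℂ), ofRealCLM.contDiff.comp χ.contMDiff.contDiff,
    hL.of_isClosed_subset (isClosed_tsupport _) hsupp, hsupp.trans hLV, fun z hz => ?_⟩
  filter_upwards [(eventually_nhdsSet_iff_forall.1 h1) z hz] with w hw
  simp [hw]

/-- The coordinate function of a subset of the plane. -/
def coordinate (K : Set ℂ) : C(K, ℂ) := ⟨Subtype.val, continuous_subtype_val⟩

theorem resolventSet_coordinate (K : Set ℂ) [CompactSpace K] :
    resolventSet ℂ (coordinate K) = Kᶜ := by
  have h : spectrum ℂ (coordinate K) = K := by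
    rw [ContinuousMap.spectrum_eq_range]
    exact Subtype.range_coe
  rw [← compl_compl (resolventSet ℂ (coordinate K))]
  exact congrArg _ h

theorem resolvent_coordinate_apply {K : Set ℂ} [CompactSpace K] {ζ : ℂ} (hζ : ζ ∉ K) (z : K) :
    resolvent (coordinate K) ζ z = (ζ - z)⁻¹ := by
  have hmem : ζ ∈ resolventSet ℂ (coordinate K) := by rwa [resolventSet_coordinate]
  have h := congrArg (fun g : C(K, ℂ) => g z) (Ring.mul_inverse_cancel _ hmem)
  exact eq_inv_of_mul_eq_one_right h

/-- The dual form of Runge's theorem. -/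
theorem StrongDual.map_holomorphic_eq_zero {K V : Set ℂ} [CompactSpace K]
    (φ : StrongDual ℂ C(K, ℂ)) (hres : ∀ ζ ∉ K, φ (resolvent (coordinate K) ζ) = 0)
    (hV : IsOpen V) (hKV : K ⊆ V) {f : ℂ → ℂ} (hf : DifferentiableOn ℂ f V) (g : C(K, ℂ))
    (hg : ∀ z : K, g z = f z) : φ g = 0 := by
  obtain ⟨χ, hχ, hc, hχV, hχK⟩ := exists_cutoff (isCompact_iff_compactSpace.2 ‹_›) hV hKV
  set c : ℂ := ∫ ζ, dbar radialCutoff ζ * ζ⁻¹ with hcdef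
  have hK : ∀ ζ ∈ tsupport (dbar χ), ζ ∉ K := fun ζ hζ hζK => notMem_tsupport_dbar (hχK ζ hζK) hζ
  have hint : Integrable fun ζ => dbar χ ζ • f ζ • resolvent (coordinate K) ζ := by
    refine integrable_dbar_smul hχ hc fun ζ hζ => ContinuousAt.fun_smul ?_ ?_
    · exact hf.continuousOn.continuousAt (hV.mem_nhds (hχV (tsupport_dbar_subset χ hζ)))
    · refine (spectrum.hasDerivAt_resolvent_const_left ?_).continuousAt
      rw [resolventSet_coordinate]
      exact hK ζ hζ
  have hcg : c • g = ∫ ζ, dbar χ ζ • f ζ • resolvent (coordinate K) ζ := by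
    ext z
    have h := (ContinuousMap.evalCLM ℂ z).integral_comp_comm hint
    rw [ContinuousMap.smul_apply, hg z, smul_eq_mul, mul_comm,
      ← integral_dbar_mul_mul_inv_sub hχ hc hV hχV hf (hχK z z.2)]
    refine Eq.trans ?_ h
    congr 1 with ζ
    by_cases hζ : ζ ∈ tsupport (dbar χ)
    · simp [resolvent_coordinate_apply (hK ζ hζ)]
    · simp [image_eq_zero_of_notMem_tsupport hζ]
  have hzero : c * φ g = 0 := by
    rw [← smul_eq_mul, ← map_smul, hcg, ← φ.integral_comp_comm hint]
    refine integral_eq_zero_of_ae (Eventually.of_forall fun ζ => ?_)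
    by_cases hζ : ζ ∈ tsupport (dbar χ)
    · simp [hres ζ (hK ζ hζ)]
    · simp [image_eq_zero_of_notMem_tsupport hζ]
  exact (mul_eq_zero.1 hzero).resolve_left integral_dbar_radialCutoff_ne_zero

namespace IsDirichletPolynomial

theorem zero : IsDirichletPolynomial 0 := ⟨0, 0, fun z => by simp⟩

theorem const_mul {D : ℂ → ℂ} (hD : IsDirichletPolynomial D) (c : ℂ) :
    IsDirichletPolynomial fun z => c * D z := by
  obtain ⟨m, a, h⟩ := hD
  refine ⟨m, fun k => c * a k, fun z => ?_⟩
  simp only [h, Finset.mul_sum, mul_assoc]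

theorem exists_extend {D : ℂ → ℂ} (hD : IsDirichletPolynomial D) :
    ∃ (m : ℕ) (a : ℕ → ℂ), ∀ n ≥ m, ∀ z, D z = ∑ k ∈ Finset.Icc 1 n, a k * (k : ℂ) ^ (-z) := by
  obtain ⟨m, a, h⟩ := hD
  refine ⟨m, fun k => if k ≤ m then a k else 0, fun n hn z => ?_⟩
  rw [h, ← Finset.sum_subset (Finset.Icc_subset_Icc_right hn)]
  · refine Finset.sum_congr rfl fun k hk => ?_
    simp only [if_pos (Finset.mem_Icc.1 hk).2]
  · intro k hk hkm
    have hlt : ¬k ≤ m := fun hle => hkm (Finset.mem_Icc.2 ⟨(Finset.mem_Icc.1 hk).1, hle⟩)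
    simp only [if_neg hlt, zero_mul]

theorem add {D E : ℂ → ℂ} (hD : IsDirichletPolynomial D) (hE : IsDirichletPolynomial E) :
    IsDirichletPolynomial fun z => D z + E z := by
  obtain ⟨m, a, ha⟩ := hD.exists_extend
  obtain ⟨n, b, hb⟩ := hE.exists_extend
  refine ⟨max m n, fun k => a k + b k, fun z => ?_⟩
  simp only [ha _ (le_max_left m n), hb _ (le_max_right m n), ← Finset.sum_add_distrib, add_mul]

theorem sum {ι : Type*} (s : Finset ι) {D : ι → ℂ → ℂ}
    (hD : ∀ i ∈ s, IsDirichletPolynomial (D i)) :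
    IsDirichletPolynomial fun z => ∑ i ∈ s, D i z := by
  classical
  induction s using Finset.induction_on with
  | empty => simpa using! zero
  | insert i s hi ih =>
    simp only [Finset.sum_insert hi]
    exact (hD i (Finset.mem_insert_self i s)).add
      (ih fun j hj => hD j (Finset.mem_insert_of_mem hj))

theorem natCast_cpow {k : ℕ} (hk : 1 ≤ k) : IsDirichletPolynomial fun z => (k : ℂ) ^ (-z) := by
  refine ⟨k, fun l => if l = k then 1 else 0, fun z => ?_⟩
  simp [hk]

theorem continuous {D : ℂ → ℂ} (hD : IsDirichletPolynomial D) : Continuous D := by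
  obtain ⟨m, a, h⟩ := hD
  rw [funext h]
  refine continuous_finsetSum _ fun k hk => continuous_const.mul ?_
  refine continuous_neg.const_cpow (Or.inl ?_)
  exact_mod_cast Nat.one_le_iff_ne_zero.1 (Finset.mem_Icc.1 hk).1

/-- The restrictions of Dirichlet polynomials to `K`. -/
def restrictions (K : Set ℂ) : Submodule ℂ C(K, ℂ) where
  carrier := {g | ∃ D, IsDirichletPolynomial D ∧ ∀ z : K, g z = D z}
  zero_mem' := ⟨0, zero, fun _ => rfl⟩
  add_mem' := by
    rintro _ _ ⟨D, hD, hgD⟩ ⟨E, hE, hgE⟩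
    exact ⟨_, hD.add hE, fun z => by simp [hgD, hgE]⟩
  smul_mem' := by
    rintro c _ ⟨D, hD, hgD⟩
    exact ⟨_, hD.const_mul c, fun z => by simp [hgD]⟩

/-- The values of Dirichlet polynomials at the points of `s`. -/
def values (s : Finset ℂ) : Submodule ℂ (s → ℂ) where
  carrier := {v | ∃ D, IsDirichletPolynomial D ∧ ∀ z : s, v z = D z}
  zero_mem' := ⟨0, zero, fun _ => rfl⟩
  add_mem' := by
    rintro _ _ ⟨D, hD, hgD⟩ ⟨E, hE, hgE⟩
    exact ⟨_, hD.add hE, fun z => by simp [hgD, hgE]⟩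
  smul_mem' := by
    rintro c _ ⟨D, hD, hgD⟩
    exact ⟨_, hD.const_mul c, fun z => by simp [hgD]⟩

end IsDirichletPolynomial

/-- Dirichlet polynomials approximate holomorphic functions on compact sets with connected
complement. -/
theorem exists_isDirichletPolynomial_approx {K V : Set ℂ} (hK : IsCompact K)
    (hc : IsConnected Kᶜ) (hV : IsOpen V) (hKV : K ⊆ V) {f : ℂ → ℂ}
    (hf : DifferentiableOn ℂ f V) {ε : ℝ} (hε : 0 < ε) :
    ∃ D, IsDirichletPolynomial D ∧ ∀ z ∈ K, ‖f z - D z‖ < ε := by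
  rcases K.eq_empty_or_nonempty with rfl | hne
  · exact ⟨0, .zero, by simp⟩
  have : CompactSpace K := isCompact_iff_compactSpace.1 hK
  have : Nonempty K := hne.to_subtype
  let g : C(K, ℂ) := ⟨K.domRestrict f, (hf.continuousOn.mono hKV).domRestrict⟩
  have hmem : g ∈ (IsDirichletPolynomial.restrictions K).topologicalClosure := by
    refine Submodule.mem_topologicalClosure_of_forall_dual _ _ fun φ hφ => ?_
    have hpow : ∀ n : ℕ, φ ((-coordinate K) ^ n) = 0 := by
      refine φ.map_pow_eq_zero_of_exp_log_smul _ fun k hk => hφ _ ?_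
      refine ⟨_, IsDirichletPolynomial.natCast_cpow hk, fun z => ?_⟩
      have hk0 : (k : ℂ) ≠ 0 := by exact_mod_cast Nat.one_le_iff_ne_zero.1 hk
      rw [NormedSpace.exp_continuousMap_eq, cpow_def_of_ne_zero hk0, ← natCast_log]
      simp [coordinate, Complex.exp_eq_exp_ℂ]
    refine φ.map_holomorphic_eq_zero (fun ζ hζ => ?_) hV hKV hf g fun z => rfl
    refine φ.map_resolvent_eq_zero _ (fun n => ?_) ?_ ?_
    · have h := hpow n
      rw [neg_pow, ← map_one (algebraMap ℂ C(K, ℂ)), ← map_neg, ← map_pow,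
        ← Algebra.smul_def, map_smul, smul_eq_zero] at h
      exact h.resolve_left (by simp)
    · rw [resolventSet_coordinate]
      exact hc.isPreconnected
    · rwa [resolventSet_coordinate]
  obtain ⟨h, ⟨D, hD, hhD⟩, hdist⟩ := Metric.mem_closure_iff.1 hmem ε hε
  refine ⟨D, hD, fun z hz => ?_⟩
  rw [dist_eq_norm] at hdist
  refine lt_of_eq_of_lt ?_ (((g - h).norm_coe_le_norm ⟨z, hz⟩).trans_lt hdist)
  rw [ContinuousMap.sub_apply, hhD]
  rfl

/-- Dirichlet polynomials interpolate arbitrary values at finitely many points. -/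
theorem exists_isDirichletPolynomial_interpolate {K : Set ℂ} (hK : IsCompact K)
    (hc : IsConnected Kᶜ) {s : Finset ℂ} (hs : (s : Set ℂ) ⊆ K) (v : ℂ → ℂ) :
    ∃ D, IsDirichletPolynomial D ∧ ∀ b ∈ s, D b = v b := by
  classical
  have hmem : (fun b : s => v b) ∈ closure (IsDirichletPolynomial.values s : Set (s → ℂ)) := by
    refine Metric.mem_closure_iff.2 fun ε hε => ?_
    set p := Lagrange.interpolate s id v
    obtain ⟨D, hD, hDp⟩ := exists_isDirichletPolynomial_approx hK hc isOpen_univ (subset_univ K)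
      (f := fun z => p.eval z) p.differentiable.differentiableOn hε
    refine ⟨fun b => D b, ⟨D, hD, fun _ => rfl⟩, (dist_pi_lt_iff hε).2 fun b => ?_⟩
    have h : p.eval (b : ℂ) = v b :=
      Lagrange.eval_interpolate_at_node v Function.injective_id.injOn b.2
    rw [dist_eq_norm, ← h]
    exact hDp b (hs b.2)
  rw [(Submodule.closed_of_finiteDimensional _).closure_eq] at hmem
  obtain ⟨D, hD, h⟩ := hmem
  exact ⟨D, hD, fun b hb => (h ⟨b, hb⟩).symm⟩

/-- Simultaneous approximation and interpolation by Dirichlet polynomials: if `K ⊆ ℂ` is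
compact with connected complement and `f` is holomorphic on an open neighbourhood of `K`,
then for any points `a_1, …, a_m ∈ K` and any `ε > 0` there is a Dirichlet polynomial `D`
which is `ε`-close to `f` on `K` and interpolates `f` at the points `a_j`. -/
theorem dirichlet_approx_interpolate (K : Set ℂ) (hK : IsCompact K)
    (hc : IsConnected Kᶜ)
    (V : Set ℂ) (hV : IsOpen V) (hKV : K ⊆ V)
    (f : ℂ → ℂ) (hf : DifferentiableOn ℂ f V)
    (m : ℕ) (a : Fin m → ℂ) (haK : ∀ j, a j ∈ K) (ε : ℝ) (hε : 0 < ε) :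
    ∃ D : ℂ → ℂ, IsDirichletPolynomial D ∧
      (∀ z ∈ K, ‖f z - D z‖ < ε) ∧
      (∀ j, D (a j) = f (a j)) := by
  classical
  set s : Finset ℂ := Finset.univ.image a
  have hsK : (s : Set ℂ) ⊆ K := by
    intro z hz
    obtain ⟨j, -, rfl⟩ := Finset.mem_image.1 hz
    exact haK j
  choose E hE hEv using fun b : ℂ =>
    exists_isDirichletPolynomial_interpolate hK hc hsK fun w => if w = b then 1 else 0
  choose B hB using fun b => hK.exists_bound_of_continuousOn (hE b).continuous.continuousOn
  set T : ℝ := 1 + ∑ b ∈ s, |B b| with hT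
  have hTpos : 0 < T := by positivity
  obtain ⟨D, hD, hfD⟩ := exists_isDirichletPolynomial_approx hK hc hV hKV hf (div_pos hε hTpos)
  refine ⟨fun z => D z + ∑ b ∈ s, (f b - D b) * E b z,
    hD.add (.sum s fun b _ => (hE b).const_mul _), fun z hz => ?_, fun j => ?_⟩
  · calc ‖f z - (D z + ∑ b ∈ s, (f b - D b) * E b z)‖
        = ‖(f z - D z) - ∑ b ∈ s, (f b - D b) * E b z‖ := by rw [sub_add_eq_sub_sub]
      _ ≤ ‖f z - D z‖ + ∑ b ∈ s, ‖(f b - D b) * E b z‖ :=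
        (norm_sub_le _ _).trans (add_le_add_right (norm_sum_le _ _) _)
      _ ≤ ‖f z - D z‖ + ∑ b ∈ s, ε / T * |B b| := by
        gcongr with b hb
        rw [norm_mul]
        exact mul_le_mul (hfD b (hsK hb)).le ((hB b z hz).trans (le_abs_self _))
          (norm_nonneg _) (by positivity)
      _ < ε / T + ∑ b ∈ s, ε / T * |B b| := add_lt_add_left (hfD z hz) _
      _ = ε / T * T := by rw [hT, mul_add, mul_one, Finset.mul_sum]
      _ = ε := div_mul_cancel₀ ε hTpos.ne'
  · have hj : a j ∈ s := Finset.mem_image_of_mem a (Finset.mem_univ j)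
    have hsum : ∑ b ∈ s, (f b - D b) * E b (a j) = f (a j) - D (a j) := by
      rw [Finset.sum_eq_single_of_mem (a j) hj fun b _ hb => ?_]
      · simp [hEv (a j) (a j) hj]
      · simp [hEv b (a j) hj, hb.symm]
    simp [hsum]
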